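/- Let F be any field and n ≥ 2. Then Sp_{2n}(F) is the universal completion of the amalgam of the maximal parabolic subgroups P_{I−{l}} = {g ∈ Sp_{2n}(F) : g C_l = C_l} (l ∈ I) for its action on Γ. Precisely: (i) Sp_{2n}(F) is generated by the union of the subgroups P_{I−{l}}, l ∈ I; and (ii) for every group K and every family of homomorphisms f_l : P_{I−{l}} → K (l ∈ I) such that f_l and f_m agree on the intersection P_{I−{l}} ∩ P_{I−{m}} for all l, m ∈ I, there exists a unique group homomorphism Φ : Sp_{2n}(F) → K with Φ restricting to f_l on P_{I−{l}} for every l ∈ I. -/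

import Mathlib

open Matrix

def Smat (F : Type) [Field F] (m : ℕ) : Matrix (Fin m) (Fin m) F :=
  Matrix.of fun i j =>
    if (i : ℕ) % 2 = 0 ∧ (j : ℕ) = (i : ℕ) + 1 then 1
    else if (j : ℕ) % 2 = 0 ∧ (i : ℕ) = (j : ℕ) + 1 then -1 else 0

/-- `V = F^{2n}`. -/
abbrev Vn (F : Type) [Field F] (n : ℕ) := Fin (2*n) → F

/-- The standard symplectic form `s` on `F^{2n}`:
`s(h_{2i−1}, h_{2i}) = 1 = −s(h_{2i}, h_{2i−1})`, all other pairs of basis vectors orthogonal. -/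
def sB (F : Type) [Field F] (n : ℕ) (v w : Vn F n) : F :=
  ∑ i, ∑ j, v i * Smat F (2*n) i j * w j

/-- `Sp_{2n}(F)`: the group of linear automorphisms of `V = F^{2n}` preserving `s`. -/
def SpV (F : Type) [Field F] (n : ℕ) : Subgroup ((Vn F n) ≃ₗ[F] (Vn F n)) where
  carrier := {g | ∀ v w, sB F n (g v) (g w) = sB F n v w}
  one_mem' := by intro v w; rfl
  mul_mem' := by
    intro a b ha hb v w
    have h : ∀ x, (a * b) x = a (b x) := fun x => rfl
    rw [h, h, ha, hb]
  inv_mem' := by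
    intro a ha v w
    have h1 := ha (a⁻¹ v) (a⁻¹ w)
    have h2 : a (a⁻¹ v) = v := by
      have := congrArg (fun (e : (Vn F n) ≃ₗ[F] (Vn F n)) => e v) (mul_inv_cancel a)
      exact this
    have h3 : a (a⁻¹ w) = w := by
      have := congrArg (fun (e : (Vn F n) ≃ₗ[F] (Vn F n)) => e w) (mul_inv_cancel a)
      exact this
    rw [h2, h3] at h1
    exact h1.symm

/-- `C_l = span(h₁, …, h_l)` (0-based: span of the `Pi.single k 1`, `k < l`). -/
def Cl (F : Type) [Field F] (n l : ℕ) : Submodule F (Vn F n) :=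
  Submodule.span F {v | ∃ k : Fin (2*n), (k : ℕ) < l ∧ v = Pi.single k 1}

/-- The subgroup of linear automorphisms stabilizing `C_l` for every `l ∈ T`. -/
def chFix (F : Type) [Field F] (n : ℕ) (T : Set ℕ) : Subgroup ((Vn F n) ≃ₗ[F] (Vn F n)) where
  carrier := {g | ∀ l ∈ T, Submodule.map (g : Vn F n →ₗ[F] Vn F n) (Cl F n l) = Cl F n l}
  one_mem' := by
    intro l _
    have : ((1 : (Vn F n) ≃ₗ[F] (Vn F n)) : Vn F n →ₗ[F] Vn F n) = LinearMap.id := rfl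
    rw [this, Submodule.map_id]
  mul_mem' := by
    intro a b ha hb l hl
    have h : ((a * b : (Vn F n) ≃ₗ[F] (Vn F n)) : Vn F n →ₗ[F] Vn F n) =
        (a : Vn F n →ₗ[F] Vn F n).comp (b : Vn F n →ₗ[F] Vn F n) := rfl
    rw [h, Submodule.map_comp, hb l hl, ha l hl]
  inv_mem' := by
    intro a ha l hl
    have h3 : Submodule.map ((a⁻¹ : (Vn F n) ≃ₗ[F] (Vn F n)) : Vn F n →ₗ[F] Vn F n)
        (Submodule.map (a : Vn F n →ₗ[F] Vn F n) (Cl F n l)) = Cl F n l := by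
      rw [← Submodule.map_comp]
      have h4 : ((a⁻¹ : (Vn F n) ≃ₗ[F] (Vn F n)) : Vn F n →ₗ[F] Vn F n).comp
          (a : Vn F n →ₗ[F] Vn F n) = LinearMap.id :=
        LinearMap.ext fun v =>
          congrArg (fun (e : (Vn F n) ≃ₗ[F] (Vn F n)) => e v) (inv_mul_cancel a)
      rw [h4, Submodule.map_id]
    rw [ha l hl] at h3
    exact h3

/-- The parabolic subgroup `P_J = {g ∈ Sp_{2n}(F) : g C_l = C_l for all l ∈ I − J}`,
where `I = {1, …, 2n−1}`. -/
def Par (F : Type) [Field F] (n : ℕ) (J : Finset ℕ) : Subgroup ((Vn F n) ≃ₗ[F] (Vn F n)) :=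
  SpV F n ⊓ chFix F n {l | l ∈ Finset.Icc 1 (2*n-1) ∧ l ∉ J}

theorem Par_le_SpV (F : Type) [Field F] (n : ℕ) (J : Finset ℕ) : Par F n J ≤ SpV F n :=
  inf_le_left

theorem Par_mono (F : Type) [Field F] (n : ℕ) {J J' : Finset ℕ} (h : J ⊆ J') :
    Par F n J ≤ Par F n J' := by
  refine inf_le_inf_left _ ?_
  intro g hg l hl
  exact hg l ⟨hl.1, fun hmem => hl.2 (h hmem)⟩

section
variable {G K : Type*} [Group G] [Group K]

/-- A map that is multiplicative along the triangles of a sufficiently connected Cayley graph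
extends to a homomorphism of the whole group. -/
theorem exists_monoidHom_of_triangles (S : Set G) (ψ : G → K)
    (htri : ∀ g ∈ S, ∀ h ∈ S, g * h ∈ S → ψ (g * h) = ψ g * ψ h)
    (htwo : ∀ g, ∃ s ∈ S, s⁻¹ * g ∈ S)
    (hquad : ∀ g s t, g ∉ S → s ∈ S → s⁻¹ * g ∈ S → t ∈ S → t⁻¹ * g ∈ S → s⁻¹ * t ∉ S →
      ∃ u ∈ S, u⁻¹ * g ∈ S ∧ s⁻¹ * u ∈ S ∧ t⁻¹ * u ∈ S)
    (hpent : ∀ g, ∀ h ∈ S, ¬ (g ∈ S ∧ g * h ∈ S) → ∃ s ∈ S, s⁻¹ * g ∈ S ∧ s⁻¹ * (g * h) ∈ S) :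
    ∃ Φ : G →* K, ∀ s ∈ S, Φ s = ψ s := by
  have step : ∀ g s t, s ∈ S → s⁻¹ * g ∈ S → t ∈ S → t⁻¹ * g ∈ S → s⁻¹ * t ∈ S →
      ψ s * ψ (s⁻¹ * g) = ψ t * ψ (t⁻¹ * g) := by
    intro g s t hs hsg ht htg hst
    have h1 := htri s hs (s⁻¹ * t) hst (by simpa using ht)
    have h2 := htri (s⁻¹ * t) hst (t⁻¹ * g) htg (by simpa [mul_assoc] using hsg)
    simp only [mul_inv_cancel_left, mul_assoc] at h1 h2
    rw [h1, h2, mul_assoc]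
  have indep : ∀ g s t, s ∈ S → s⁻¹ * g ∈ S → t ∈ S → t⁻¹ * g ∈ S →
      ψ s * ψ (s⁻¹ * g) = ψ t * ψ (t⁻¹ * g) := by
    intro g s t hs hsg ht htg
    by_cases hg : g ∈ S
    · rw [← htri s hs _ hsg (by simpa using hg), ← htri t ht _ htg (by simpa using hg)]
      simp
    by_cases hst : s⁻¹ * t ∈ S
    · exact step g s t hs hsg ht htg hst
    obtain ⟨u, hu, hug, hsu, htu⟩ := hquad g s t hg hs hsg ht htg hst
    rw [step g s u hs hsg hu hug hsu, step g t u ht htg hu hug htu]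
  choose σ hσ hσg using htwo
  set φ : G → K := fun g => ψ (σ g) * ψ ((σ g)⁻¹ * g) with hφ
  have eqφ : ∀ g s, s ∈ S → s⁻¹ * g ∈ S → φ g = ψ s * ψ (s⁻¹ * g) := fun g s hs hsg =>
    indep g _ s (hσ g) (hσg g) hs hsg
  have φS : ∀ g ∈ S, φ g = ψ g := by
    intro g hg
    rw [hφ]
    simp only
    rw [← htri _ (hσ g) _ (hσg g) (by simpa using hg)]
    simp
  have φmulS : ∀ g, ∀ h ∈ S, φ (g * h) = φ g * ψ h := by
    intro g h hh
    by_cases hc : g ∈ S ∧ g * h ∈ S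
    · rw [φS _ hc.1, φS _ hc.2, htri g hc.1 h hh hc.2]
    · obtain ⟨s, hs, hsg, hsgh⟩ := hpent g h hh hc
      rw [eqφ _ s hs hsg, eqφ _ s hs hsgh, ← mul_assoc s⁻¹ g h,
        htri _ hsg _ hh (by rwa [mul_assoc]), mul_assoc]
  have φmul : ∀ g h, φ (g * h) = φ g * φ h := by
    intro g h
    rw [eqφ h (σ h) (hσ h) (hσg h), ← mul_assoc, ← φmulS g _ (hσ h), ← φmulS _ _ (hσg h)]
    simp [mul_assoc]
  exact ⟨MonoidHom.mk' φ φmul, φS⟩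

/-- A map that is multiplicative on the subgroup `P`. -/
def MulOn (P : Subgroup G) (p : G → K) : Prop :=
  ∀ a ∈ P, ∀ b ∈ P, p (a * b) = p a * p b

/-- Maps on three subgroups that are multiplicative and agree on intersections extend to the whole
group, provided that every triangle of the Cayley graph on `S` can be moved into `R`. -/
theorem exists_monoidHom_of_three_subgroups (P Q R : Subgroup G) (S : Set G) (p q r : G → K)
    (hp : MulOn P p) (hq : MulOn Q q) (hr : MulOn R r)
    (hpq : ∀ g ∈ P, g ∈ Q → p g = q g) (hpr : ∀ g ∈ P, g ∈ R → p g = r g)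
    (hqr : ∀ g ∈ Q, g ∈ R → q g = r g)
    (hleft : ∀ a ∈ P, ∀ s ∈ S, a * s ∈ S) (hright : ∀ a ∈ P, ∀ s ∈ S, s * a ∈ S)
    (hS : ∀ g ∈ S, ∃ a ∈ P, ∃ w ∈ Q, ∃ b ∈ P, g = a * w * b)
    (hQS : ∀ w ∈ Q, w ∉ S → w ∈ P)
    (hPQ : ∀ a ∈ P, ∀ w ∈ Q, ∀ w' ∈ Q, w ∈ S → w' ∈ S → w'⁻¹ * (a * w) ∈ P → a ∈ Q)
    (hRS : ∀ g ∈ S, g ∈ R → ∃ a ∈ P ⊓ R, ∃ w ∈ Q ⊓ R, ∃ b ∈ P ⊓ R, g = a * w * b)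
    (hR : ∀ g ∈ R, ∃ s ∈ S, s ∈ R ∧ s⁻¹ * g ∈ S)
    (htri : ∀ g ∈ S, ∀ h ∈ S, g * h ∈ S →
      ∃ a ∈ P, ∃ b ∈ P, ∃ c ∈ P, a * g * b ∈ R ∧ b⁻¹ * h * c ∈ R)
    (htwo : ∀ g, ∃ s ∈ S, s⁻¹ * g ∈ S)
    (hquad : ∀ g s t, g ∉ S → s ∈ S → s⁻¹ * g ∈ S → t ∈ S → t⁻¹ * g ∈ S → s⁻¹ * t ∉ S →
      ∃ u ∈ S, u⁻¹ * g ∈ S ∧ s⁻¹ * u ∈ S ∧ t⁻¹ * u ∈ S)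
    (hpent : ∀ g, ∀ h ∈ S, ¬ (g ∈ S ∧ g * h ∈ S) → ∃ s ∈ S, s⁻¹ * g ∈ S ∧ s⁻¹ * (g * h) ∈ S) :
    ∃ Φ : G →* K, (∀ g ∈ P, Φ g = p g) ∧ (∀ g ∈ Q, Φ g = q g) ∧ ∀ g ∈ R, Φ g = r g := by
  have p1 : p 1 = 1 := by simpa using hp 1 P.one_mem 1 P.one_mem
  have midS : ∀ a ∈ P, ∀ w, ∀ b ∈ P, a * w * b ∈ S → w ∈ S := by
    intro a ha w b hb h
    have := hleft _ (P.inv_mem ha) _ (hright _ (P.inv_mem hb) _ h)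
    simpa [mul_assoc] using this
  have wd : ∀ a ∈ P, ∀ w ∈ Q, ∀ b ∈ P, ∀ a' ∈ P, ∀ w' ∈ Q, ∀ b' ∈ P, a * w * b ∈ S →
      a * w * b = a' * w' * b' → p a * q w * p b = p a' * q w' * p b' := by
    intro a ha w hw b hb a' ha' w' hw' b' hb' hs he
    have hwS := midS a ha w b hb hs
    have hwS' := midS a' ha' w' b' hb' (he ▸ hs)
    obtain ⟨c, rfl⟩ : ∃ c, a = a' * c := ⟨a'⁻¹ * a, by simp⟩
    obtain ⟨d, rfl⟩ : ∃ d, b' = d * b := ⟨b' * b⁻¹, by simp⟩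
    have hc : c ∈ P := by simpa using P.mul_mem (P.inv_mem ha') ha
    have hd : d ∈ P := by simpa using P.mul_mem hb' (P.inv_mem hb)
    have hcd : c * w = w' * d := by
      simp only [mul_assoc, mul_right_inj] at he
      simp only [← mul_assoc, mul_left_inj] at he
      exact he
    have hd' : d = w'⁻¹ * (c * w) := by rw [hcd]; simp
    have hcQ : c ∈ Q := hPQ c hc w hw w' hw' hwS hwS' (hd' ▸ hd)
    have hdQ : d ∈ Q := hd' ▸ Q.mul_mem (Q.inv_mem hw') (Q.mul_mem hcQ hw)
    have key : q c * q w = q w' * q d := by rw [← hq c hcQ w hw, hcd, hq w' hw' d hdQ]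
    rw [hp a' ha' c hc, hp d hd b hb, hpq c hc hcQ, hpq d hd hdQ, mul_assoc (p a'), key]
    simp only [mul_assoc]
  have exψ : ∀ g, ∃ k, g ∈ S → ∀ a ∈ P, ∀ w ∈ Q, ∀ b ∈ P, g = a * w * b →
      k = p a * q w * p b := by
    intro g
    by_cases hg : g ∈ S
    · obtain ⟨a, ha, w, hw, b, hb, rfl⟩ := hS g hg
      exact ⟨_, fun _ a' ha' w' hw' b' hb' he => wd a ha w hw b hb a' ha' w' hw' b' hb' hg he⟩
    · exact ⟨1, fun h => absurd h hg⟩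
  choose ψ hψ using exψ
  have ψleft : ∀ a ∈ P, ∀ g ∈ S, ψ (a * g) = p a * ψ g := by
    intro a ha g hg
    obtain ⟨a', ha', w, hw, b, hb, he⟩ := hS g hg
    rw [hψ g hg a' ha' w hw b hb he, hψ (a * g) (hleft a ha g hg) (a * a') (P.mul_mem ha ha') w hw
      b hb (by rw [he]; simp only [mul_assoc]), hp a ha a' ha']
    simp only [mul_assoc]
  have ψright : ∀ a ∈ P, ∀ g ∈ S, ψ (g * a) = ψ g * p a := by
    intro a ha g hg
    obtain ⟨a', ha', w, hw, b, hb, he⟩ := hS g hg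
    rw [hψ g hg a' ha' w hw b hb he, hψ (g * a) (hright a ha g hg) a' ha' w hw (b * a)
      (P.mul_mem hb ha) (by rw [he]; simp only [mul_assoc]), hp b hb a ha]
    simp only [mul_assoc]
  have ψR : ∀ g ∈ S, g ∈ R → ψ g = r g := by
    intro g hg hgR
    obtain ⟨a, ha, w, hw, b, hb, he⟩ := hRS g hg hgR
    rw [hψ g hg a ha.1 w hw.1 b hb.1 he, hpr a ha.1 ha.2, hqr w hw.1 hw.2, hpr b hb.1 hb.2, he,
      hr _ (R.mul_mem ha.2 hw.2) b hb.2, hr a ha.2 w hw.2]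
  have ψtri : ∀ g ∈ S, ∀ h ∈ S, g * h ∈ S → ψ (g * h) = ψ g * ψ h := by
    intro g hg h hh hgh
    obtain ⟨a, ha, b, hb, c, hc, hu, hv⟩ := htri g hg h hh hgh
    have hag := hleft a ha g hg
    have hagb := hright b hb _ hag
    have hbh := hleft _ (P.inv_mem hb) h hh
    have hbhc := hright c hc _ hbh
    have hagh := hleft a ha _ hgh
    have haghc := hright c hc _ hagh
    have e : a * (g * h) * c = a * g * b * (b⁻¹ * h * c) := by simp [mul_assoc]
    have h1 : ψ (a * (g * h) * c) = ψ (a * g * b) * ψ (b⁻¹ * h * c) := by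
      rw [ψR _ haghc (e ▸ R.mul_mem hu hv), e, hr _ hu _ hv, ψR _ hagb hu, ψR _ hbhc hv]
    have hb1 : p b * p b⁻¹ = 1 := by rw [← hp b hb _ (P.inv_mem hb), mul_inv_cancel, p1]
    rw [ψright c hc _ hagh, ψright c hc _ hbh, ψright b hb _ hag, ψleft a ha _ hgh,
      ψleft a ha _ hg, ψleft _ (P.inv_mem hb) _ hh] at h1
    have h2 : p a * ψ (g * h) * p c = p a * (ψ g * (p b * p b⁻¹) * ψ h) * p c := by
      rw [h1]; simp only [mul_assoc]
    rw [hb1, mul_one] at h2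
    exact mul_left_cancel (mul_right_cancel h2)
  obtain ⟨Φ, hΦ⟩ := exists_monoidHom_of_triangles S ψ ψtri htwo hquad hpent
  have ΦP : ∀ g ∈ P, Φ g = p g := by
    intro g hg
    obtain ⟨s, hs, -⟩ := htwo 1
    have h1 : Φ (s * g) = ψ (s * g) := hΦ _ (hright g hg s hs)
    rw [map_mul, hΦ s hs, ψright g hg s hs] at h1
    exact mul_left_cancel h1
  refine ⟨Φ, ΦP, fun g hg => ?_, fun g hg => ?_⟩
  · by_cases hgS : g ∈ S
    · rw [hΦ g hgS, hψ g hgS 1 P.one_mem g hg 1 P.one_mem (by simp), p1]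
      simp
    · have := hQS g hg hgS
      rw [ΦP g this, hpq g this hg]
  · obtain ⟨s, hs, hsR, hsg⟩ := hR g hg
    have hsgR := R.mul_mem (R.inv_mem hsR) hg
    have e : g = s * (s⁻¹ * g) := by simp
    rw [e, map_mul, hΦ s hs, hΦ _ hsg, ψR s hs hsR, ψR _ hsg hsgR, hr s hsR _ hsgR]

end

section
variable {F : Type} [Field F] {n : ℕ}

theorem sB_add_left (u v w : Vn F n) : sB F n (u + v) w = sB F n u w + sB F n v w := by
  simp [sB, add_mul, Finset.sum_add_distrib]

theorem sB_add_right (u v w : Vn F n) : sB F n u (v + w) = sB F n u v + sB F n u w := by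
  simp [sB, mul_add, Finset.sum_add_distrib]

theorem sB_smul_left (c : F) (v w : Vn F n) : sB F n (c • v) w = c * sB F n v w := by
  simp [sB, mul_assoc, Finset.mul_sum]

theorem sB_smul_right (c : F) (v w : Vn F n) : sB F n v (c • w) = c * sB F n v w := by
  simp only [sB, Finset.mul_sum, Pi.smul_apply, smul_eq_mul]
  exact Finset.sum_congr rfl fun i _ => Finset.sum_congr rfl fun j _ => by ring

theorem Smat_swap (m : ℕ) (i j : Fin m) : Smat F m j i = - Smat F m i j := by
  simp only [Smat, Matrix.of_apply]
  split_ifs <;> first | omega | simp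

theorem sB_swap (v w : Vn F n) : sB F n w v = - sB F n v w := by
  simp only [sB]
  rw [Finset.sum_comm, ← Finset.sum_neg_distrib]
  refine Finset.sum_congr rfl fun i _ => ?_
  rw [← Finset.sum_neg_distrib]
  refine Finset.sum_congr rfl fun j _ => ?_
  rw [Smat_swap]
  ring

theorem sB_self (v : Vn F n) : sB F n v v = 0 := by
  set L : Fin (2*n) → Fin (2*n) → F := fun i j => if (i : ℕ) % 2 = 0 ∧ (j : ℕ) = i + 1 then 1 else 0
  have h : ∀ i j, Smat F (2*n) i j = L i j - L j i := by
    intro i j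
    simp only [Smat, Matrix.of_apply, L]
    split_ifs <;> first | omega | simp
  simp only [sB, h, mul_sub, sub_mul, Finset.sum_sub_distrib]
  rw [sub_eq_zero, Finset.sum_comm]
  exact Finset.sum_congr rfl fun i _ => Finset.sum_congr rfl fun j _ => by ring

theorem sB_neg_left (v w : Vn F n) : sB F n (-v) w = - sB F n v w := by
  simp [sB]

theorem sB_neg_right (v w : Vn F n) : sB F n v (-w) = - sB F n v w := by
  simp [sB]

theorem sB_sub_left (u v w : Vn F n) : sB F n (u - v) w = sB F n u w - sB F n v w := by
  rw [sub_eq_add_neg, sB_add_left, sB_neg_left, sub_eq_add_neg]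

theorem sB_sub_right (u v w : Vn F n) : sB F n u (v - w) = sB F n u v - sB F n u w := by
  rw [sub_eq_add_neg, sB_add_right, sB_neg_right, sub_eq_add_neg]

/-- The functional `s(v, ·)`. -/
def sDual (v : Vn F n) : Vn F n →ₗ[F] F where
  toFun w := sB F n v w
  map_add' := sB_add_right v
  map_smul' c w := sB_smul_right c v w

theorem sDual_apply (v w : Vn F n) : sDual v w = sB F n v w := rfl

theorem sB_ne_zero_comm {v w : Vn F n} : sB F n v w ≠ 0 ↔ sB F n w v ≠ 0 := by
  rw [sB_swap w v, neg_ne_zero]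

theorem sB_eq_zero_comm {v w : Vn F n} : sB F n v w = 0 ↔ sB F n w v = 0 := by
  rw [sB_swap w v, neg_eq_zero]

/-- The basis vector with index `k`, counted from `0`. -/
def bvec (F : Type) [Field F] (n k : ℕ) : Vn F n := fun i => if (i : ℕ) = k then 1 else 0

theorem bvec_apply (k : ℕ) (i : Fin (2*n)) : bvec F n k i = if (i : ℕ) = k then 1 else 0 := rfl

theorem sB_bvec_even {k : ℕ} (hk : k % 2 = 0) (h : k + 1 < 2*n) (z : Vn F n) :
    sB F n (bvec F n k) z = z ⟨k + 1, h⟩ := by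
  rw [sB, Finset.sum_eq_single ⟨k, by omega⟩, Finset.sum_eq_single ⟨k + 1, h⟩]
  · simp [bvec, Smat, hk]
  · intro j _ hj
    have : (j : ℕ) ≠ k + 1 := fun e => hj (Fin.ext e)
    simp only [Smat, Matrix.of_apply]
    rw [if_neg (by simp [this]), if_neg (by omega)]
    simp
  · simp
  · intro i _ hi
    have : (i : ℕ) ≠ k := fun e => hi (Fin.ext e)
    simp [bvec, this]
  · simp

theorem sB_bvec_odd {k : ℕ} (hk : k % 2 = 0) (h : k + 1 < 2*n) (z : Vn F n) :
    sB F n (bvec F n (k + 1)) z = - z ⟨k, by omega⟩ := by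
  rw [sB, Finset.sum_eq_single ⟨k + 1, h⟩, Finset.sum_eq_single ⟨k, by omega⟩]
  · simp only [Smat, Matrix.of_apply, bvec]
    rw [if_pos trivial, if_neg (by omega), if_pos ⟨hk, trivial⟩]
    simp
  · intro j _ hj
    have : (j : ℕ) ≠ k := fun e => hj (Fin.ext e)
    simp only [Smat, Matrix.of_apply]
    rw [if_neg (by omega), if_neg (fun e => this (Nat.succ_injective e.2).symm)]
    simp
  · simp
  · intro i _ hi
    have : (i : ℕ) ≠ k + 1 := fun e => hi (Fin.ext e)
    simp [bvec, this]
  · simp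

theorem exists_sB_ne_zero {z : Vn F n} (hz : z ≠ 0) : ∃ c, sB F n c z ≠ 0 := by
  obtain ⟨k, hk⟩ : ∃ k, z k ≠ 0 := Function.ne_iff.mp hz
  rcases Nat.mod_two_eq_zero_or_one k with h | h
  · refine ⟨bvec F n (k + 1), ?_⟩
    rw [sB_bvec_odd h (by omega), neg_ne_zero]
    exact hk
  · refine ⟨bvec F n (k - 1), ?_⟩
    rw [sB_bvec_even (by omega) (by omega)]
    convert hk using 2
    exact Fin.ext (by simp; omega)

theorem mem_Cl {l : ℕ} {v : Vn F n} : v ∈ Cl F n l ↔ ∀ k : Fin (2*n), l ≤ k → v k = 0 := by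
  constructor
  · intro h
    induction h using Submodule.span_induction with
    | mem x hx =>
      obtain ⟨k, hk, rfl⟩ := hx
      intro j hj
      exact Pi.single_eq_of_ne (by rintro rfl; omega) _
    | zero => simp
    | add x y _ _ hx hy => intro k hk; simp [hx k hk, hy k hk]
    | smul c x _ hx => intro k hk; simp [hx k hk]
  · intro h
    have e : v = ∑ k, v k • (Pi.single k 1 : Vn F n) := by
      ext i
      simp [Finset.sum_apply, Pi.single_apply]
    rw [e]
    refine Submodule.sum_mem _ fun k _ => ?_
    by_cases hk : (k : ℕ) < l
    · exact Submodule.smul_mem _ _ (Submodule.subset_span ⟨k, hk, rfl⟩)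
    · rw [h k (by omega), zero_smul]
      exact Submodule.zero_mem _

theorem bvec_mem_Cl {k l : ℕ} (h : k < l) : bvec F n k ∈ Cl F n l := by
  rw [mem_Cl]
  intro i hi
  rw [bvec_apply, if_neg (by omega)]

theorem map_Cl_eq_iff (g : Vn F n ≃ₗ[F] Vn F n) (l : ℕ) :
    Submodule.map (g : Vn F n →ₗ[F] Vn F n) (Cl F n l) = Cl F n l ↔
      ∀ u ∈ Cl F n l, g u ∈ Cl F n l := by
  constructor
  · intro h u hu
    rw [← h]
    exact Submodule.mem_map_of_mem hu
  · intro h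
    refine Submodule.eq_of_le_of_finrank_eq ?_ (LinearEquiv.finrank_map_eq g _)
    rintro _ ⟨u, hu, rfl⟩
    exact h u hu

theorem mem_Par_iff {l : ℕ} (hl : l ∈ Finset.Icc 1 (2*n-1)) (g : SpV F n) :
    (g : Vn F n ≃ₗ[F] Vn F n) ∈ Par F n (Finset.Icc 1 (2*n-1) \ {l}) ↔
      ∀ u ∈ Cl F n l, g.1 u ∈ Cl F n l := by
  rw [← map_Cl_eq_iff]
  constructor
  · intro h
    exact h.2 l ⟨hl, by simp⟩
  · intro h
    refine ⟨g.2, ?_⟩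
    rintro m ⟨hm, hm'⟩
    have : m = l := by
      by_contra hne
      exact hm' (by simp only [Finset.mem_sdiff, Finset.mem_singleton]; exact ⟨hm, hne⟩)
    rw [this]
    exact h

theorem sB_map (g : SpV F n) (v w : Vn F n) : sB F n (g.1 v) (g.1 w) = sB F n v w := g.2 v w

theorem coe_mul_apply (g h : SpV F n) (v : Vn F n) : (g * h).1 v = g.1 (h.1 v) := rfl

theorem coe_one_apply (v : Vn F n) : (1 : SpV F n).1 v = v := rfl

theorem inv_apply_eq {g : SpV F n} {v w : Vn F n} : g⁻¹.1 v = w ↔ v = g.1 w := by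
  constructor
  · rintro rfl
    rw [← coe_mul_apply, mul_inv_cancel, coe_one_apply]
  · rintro rfl
    rw [← coe_mul_apply, inv_mul_cancel, coe_one_apply]

theorem sB_inv_right (g : SpV F n) (v w : Vn F n) :
    sB F n v (g⁻¹.1 w) = sB F n (g.1 v) w := by
  rw [← sB_map g, ← coe_mul_apply, mul_inv_cancel, coe_one_apply]

/-- A symplectic transvection moving `x` to `y`. -/
theorem exists_transvection {x y : Vn F n} (h : sB F n x y ≠ 0) :
    ∃ g : SpV F n, g.1 x = y ∧ ∀ u, ∃ a : F, g.1 u = u + (a * sB F n (y - x) u) • (y - x) := by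
  set v := y - x with hv
  set c := (sB F n y x)⁻¹ with hc
  have h0 : (c • sDual v) v = 0 := by
    simp [sDual_apply, sB_self]
  have happ : ∀ u, LinearEquiv.transvection h0 u = u + (c * sB F n v u) • v := by
    intro u
    rw [LinearEquiv.transvection.apply]
    rfl
  refine ⟨⟨LinearEquiv.transvection h0, ?_⟩, ?_, fun u => ⟨c, happ u⟩⟩
  · intro a b
    rw [happ, happ]
    simp only [sB_add_left, sB_add_right, sB_smul_left, sB_smul_right, sB_self]
    rw [sB_swap v a]
    ring
  · change LinearEquiv.transvection h0 x = y
    have : c * sB F n v x = 1 := by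
      rw [hv, sB_sub_left, sB_self, sub_zero]
      exact inv_mul_cancel₀ (sB_ne_zero_comm.mp h)
    rw [happ, this, one_smul, hv]
    abel

theorem exists_move_via {x c y : Vn F n} (hxc : sB F n x c ≠ 0) (hcy : sB F n c y ≠ 0) :
    ∃ g : SpV F n, g.1 x = y ∧
      (∀ u, sB F n (c - x) u = 0 → sB F n (y - c) u = 0 → g.1 u = u) ∧
      ∀ U : Submodule F (Vn F n), c - x ∈ U → y - c ∈ U → ∀ u ∈ U, g.1 u ∈ U := by
  obtain ⟨g, hg, hg'⟩ := exists_transvection hxc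
  obtain ⟨h, hh, hh'⟩ := exists_transvection hcy
  refine ⟨h * g, ?_, ?_, ?_⟩
  · rw [coe_mul_apply, hg, hh]
  · intro u h1 h2
    obtain ⟨a, ha⟩ := hg' u
    obtain ⟨b, hb⟩ := hh' u
    rw [h1, mul_zero, zero_smul, add_zero] at ha
    rw [h2, mul_zero, zero_smul, add_zero] at hb
    rw [coe_mul_apply, ha, hb]
  · intro U h1 h2 u hu
    obtain ⟨a, ha⟩ := hg' u
    obtain ⟨b, hb⟩ := hh' (g.1 u)
    rw [coe_mul_apply, hb, ha]
    exact U.add_mem (U.add_mem hu (U.smul_mem _ h1)) (U.smul_mem _ h2)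

/-- Two functionals that do not vanish on `U` have a common point of nonvanishing in `U`. -/
theorem exists_common_ne_zero (U : Submodule F (Vn F n)) {x y : Vn F n}
    (hx : ∃ c ∈ U, sB F n c x ≠ 0) (hy : ∃ c ∈ U, sB F n c y ≠ 0) :
    ∃ c ∈ U, sB F n c x ≠ 0 ∧ sB F n c y ≠ 0 := by
  obtain ⟨c, hc, hcx⟩ := hx
  obtain ⟨d, hd, hdy⟩ := hy
  by_cases hcy : sB F n c y = 0
  · by_cases hdx : sB F n d x = 0
    · refine ⟨c + d, U.add_mem hc hd, ?_⟩
      simp [sB_add_left, hcy, hdx, hcx, hdy]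
    · exact ⟨d, hd, hdx, hdy⟩
  · exact ⟨c, hc, hcx, hcy⟩

theorem exists_move_in (U : Submodule F (Vn F n)) {x y : Vn F n} (hxU : x ∈ U) (hyU : y ∈ U)
    (hx : ∃ c ∈ U, sB F n c x ≠ 0) (hy : ∃ c ∈ U, sB F n c y ≠ 0) :
    ∃ g : SpV F n, g.1 x = y ∧ (∀ u, (∀ v ∈ U, sB F n v u = 0) → g.1 u = u) ∧
      ∀ u ∈ U, g.1 u ∈ U := by
  obtain ⟨c, hc, hcx, hcy⟩ := exists_common_ne_zero U hx hy
  obtain ⟨g, hg, h1, h2⟩ := exists_move_via (sB_ne_zero_comm.mp hcx) hcy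
  exact ⟨g, hg, fun u hu => h1 u (hu _ (U.sub_mem hc hxU)) (hu _ (U.sub_mem hyU hc)),
    h2 U (U.sub_mem hc hxU) (U.sub_mem hyU hc)⟩

end

section
variable {F : Type} [Field F] {n : ℕ}

/-- The stabilizer of `C_l` as a subgroup of the symplectic group. -/
def stab (F : Type) [Field F] (n l : ℕ) : Subgroup (SpV F n) :=
  (Par F n (Finset.Icc 1 (2*n-1) \ {l})).subgroupOf (SpV F n)

theorem mem_stab {l : ℕ} (h1 : 1 ≤ l) (h2 : l ≤ 2*n-1) {g : SpV F n} :
    g ∈ stab F n l ↔ ∀ u ∈ Cl F n l, g.1 u ∈ Cl F n l := by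
  rw [stab, Subgroup.mem_subgroupOf, mem_Par_iff (Finset.mem_Icc.mpr ⟨h1, h2⟩)]

theorem mem_Cl_one (hn : 2 ≤ n) {v : Vn F n} : v ∈ Cl F n 1 ↔ ∃ c : F, v = c • bvec F n 0 := by
  constructor
  · intro h
    rw [mem_Cl] at h
    refine ⟨v ⟨0, by omega⟩, ?_⟩
    ext i
    by_cases hi : (i : ℕ) = 0
    · rw [show i = ⟨0, by omega⟩ from Fin.ext hi]
      simp [bvec_apply]
    · simp [bvec_apply, hi, h i (by omega)]
  · rintro ⟨c, rfl⟩
    exact Submodule.smul_mem _ _ (bvec_mem_Cl one_pos)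

theorem mem_Cl_two (hn : 2 ≤ n) {v : Vn F n} :
    v ∈ Cl F n 2 ↔ ∃ a b : F, v = a • bvec F n 0 + b • bvec F n 1 := by
  constructor
  · intro h
    rw [mem_Cl] at h
    refine ⟨v ⟨0, by omega⟩, v ⟨1, by omega⟩, ?_⟩
    ext i
    by_cases hi : (i : ℕ) = 0
    · rw [show i = ⟨0, by omega⟩ from Fin.ext hi]
      simp [bvec_apply]
    · by_cases hi' : (i : ℕ) = 1
      · rw [show i = ⟨1, by omega⟩ from Fin.ext hi']
        simp [bvec_apply]
      · simp [bvec_apply, hi, hi', h i (by omega)]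
  · rintro ⟨a, b, rfl⟩
    exact Submodule.add_mem _ (Submodule.smul_mem _ _ (bvec_mem_Cl two_pos))
      (Submodule.smul_mem _ _ (bvec_mem_Cl one_lt_two))

theorem mem_Cl_last (hn : 2 ≤ n) {v : Vn F n} :
    v ∈ Cl F n (2*n-1) ↔ sB F n v (bvec F n (2*n-2)) = 0 := by
  rw [sB_eq_zero_comm, sB_bvec_even (by omega) (by omega), mem_Cl]
  constructor
  · intro h
    exact h _ (by simp only; omega)
  · intro h k hk
    rw [← h]
    congr 1
    exact Fin.ext (by simp only; omega)

theorem sB_bvec_zero_one (hn : 2 ≤ n) : sB F n (bvec F n 0) (bvec F n 1) = 1 := by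
  rw [sB_bvec_even rfl (by omega)]
  simp [bvec_apply]

theorem sB_bvec_last_left (hn : 2 ≤ n) {k : ℕ} (hk : k < 2*n-1) :
    sB F n (bvec F n k) (bvec F n (2*n-2)) = 0 :=
  (mem_Cl_last hn).mp (bvec_mem_Cl hk)

theorem sB_bvec_last (hn : 2 ≤ n) :
    sB F n (bvec F n (2*n-1)) (bvec F n (2*n-2)) ≠ 0 := by
  rw [sB_ne_zero_comm, sB_bvec_even (by omega) (by omega), bvec_apply, if_pos (by simp only; omega)]
  exact one_ne_zero

theorem sB_bvec_zero_last (hn : 2 ≤ n) :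
    sB F n (bvec F n 0) (bvec F n (2*n-1)) = 0 := by
  rw [sB_bvec_even rfl (by omega), bvec_apply, if_neg (by simp only; omega)]

theorem mem_stab_one (hn : 2 ≤ n) {g : SpV F n} :
    g ∈ stab F n 1 ↔ ∃ c : F, g.1 (bvec F n 0) = c • bvec F n 0 := by
  rw [mem_stab le_rfl (by omega)]
  constructor
  · intro h
    exact (mem_Cl_one hn).mp (h _ (bvec_mem_Cl one_pos))
  · rintro ⟨c, hc⟩ u hu
    obtain ⟨b, rfl⟩ := (mem_Cl_one hn).mp hu
    rw [map_smul, hc]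
    exact Submodule.smul_mem _ _ ((mem_Cl_one hn).mpr ⟨c, rfl⟩)

theorem mem_stab_one_of_eq (hn : 2 ≤ n) {g : SpV F n} (h : g.1 (bvec F n 0) = bvec F n 0) :
    g ∈ stab F n 1 :=
  (mem_stab_one hn).mpr ⟨1, by rw [h, one_smul]⟩

theorem mem_stab_last_of_eq (hn : 2 ≤ n) {g : SpV F n}
    (h : g.1 (bvec F n (2*n-2)) = bvec F n (2*n-2)) : g ∈ stab F n (2*n-1) := by
  rw [mem_stab (by omega) le_rfl]
  intro u hu
  rw [mem_Cl_last hn] at hu ⊢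
  rw [← hu, ← sB_map g u, h]

theorem exists_fix_move_one (hn : 2 ≤ n) {x : Vn F n} (hx : sB F n (bvec F n 0) x ≠ 0) :
    ∃ a : SpV F n, a.1 (bvec F n 0) = bvec F n 0 ∧
      a.1 (bvec F n 1) = (sB F n (bvec F n 0) x)⁻¹ • x ∧
      (sB F n x (bvec F n (2*n-2)) = 0 → a.1 (bvec F n (2*n-2)) = bvec F n (2*n-2)) := by
  have hef := sB_bvec_zero_one (F := F) hn
  have hfe : sB F n (bvec F n 1) (bvec F n 0) = -1 := by rw [sB_swap, hef]
  have hed := sB_bvec_last_left (F := F) hn (k := 0) (by omega)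
  have hfd := sB_bvec_last_left (F := F) hn (k := 1) (by omega)
  set y := (sB F n (bvec F n 0) x)⁻¹ • x with hy
  have hey : sB F n (bvec F n 0) y = 1 := by rw [hy, sB_smul_right, inv_mul_cancel₀ hx]
  have hye : sB F n y (bvec F n 0) = -1 := by rw [sB_swap, hey]
  by_cases h : sB F n (bvec F n 1) y = 0
  · obtain ⟨g, hg, hfix, -⟩ := exists_move_via (x := bvec F n 1) (c := bvec F n 1 + bvec F n 0)
      (y := y) (by simp [sB_add_right, sB_self, hfe]) (by simp [sB_add_left, h, hey])
    refine ⟨g, hfix _ ?_ ?_, hg, fun hxd => hfix _ ?_ ?_⟩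
    · simp [sB_self]
    · simp [sB_sub_left, sB_add_left, sB_self, hye, hfe]
    · simp [hed]
    · simp [sB_sub_left, sB_add_left, hed, hfd, hy, sB_smul_left, hxd]
  · obtain ⟨g, hg, hfix⟩ := exists_transvection h
    refine ⟨g, ?_, hg, fun hxd => ?_⟩
    · obtain ⟨a, ha⟩ := hfix (bvec F n 0)
      rw [ha]
      simp [sB_sub_left, hye, hfe]
    · obtain ⟨a, ha⟩ := hfix (bvec F n (2*n-2))
      rw [ha]
      simp [sB_sub_left, hfd, hy, sB_smul_left, hxd]

theorem exists_stab_last_move (hn : 2 ≤ n) {x : Vn F n} (hx : sB F n x (bvec F n (2*n-2)) = 0)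
    (hx' : ∃ c, sB F n c (bvec F n (2*n-2)) = 0 ∧ sB F n c x ≠ 0) :
    ∃ u ∈ stab F n (2*n-1), u.1 (bvec F n 0) = x := by
  obtain ⟨c, hc, hcx⟩ := hx'
  obtain ⟨g, hg, -, hU⟩ := exists_move_in (Cl F n (2*n-1)) (bvec_mem_Cl (k := 0) (by omega))
    ((mem_Cl_last hn).mpr hx)
    ⟨bvec F n 1, bvec_mem_Cl (by omega), by
      rw [sB_ne_zero_comm, sB_bvec_zero_one hn]; exact one_ne_zero⟩
    ⟨c, (mem_Cl_last hn).mpr hc, hcx⟩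
  exact ⟨g, (mem_stab (by omega) le_rfl).mpr hU, hg⟩

theorem bvec_zero_ne_zero (hn : 2 ≤ n) : bvec F n 0 ≠ 0 := by
  intro h
  have := sB_bvec_zero_one (F := F) hn
  rw [h] at this
  simp [sB] at this

theorem exists_move_first (hn : 2 ≤ n) {x : Vn F n} (hx : x ≠ 0) :
    ∃ g : SpV F n, g.1 (bvec F n 0) = x := by
  obtain ⟨c, hc⟩ := exists_sB_ne_zero (bvec_zero_ne_zero (F := F) hn)
  obtain ⟨c', hc'⟩ := exists_sB_ne_zero hx
  obtain ⟨g, hg, -⟩ := exists_move_in ⊤ (x := bvec F n 0) (y := x) trivial trivial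
    ⟨c, trivial, hc⟩ ⟨c', trivial, hc'⟩
  exact ⟨g, hg⟩

theorem exists_orthogonal_ne_zero (hn : 2 ≤ n) (x y w : Vn F n) :
    ∃ z ≠ 0, sB F n x z = 0 ∧ sB F n y z = 0 ∧ sB F n w z = 0 := by
  have h : LinearMap.ker (LinearMap.pi ![sDual x, sDual y, sDual w]) ≠ ⊥ := by
    apply LinearMap.ker_ne_bot_of_finrank_lt
    simp
    omega
  obtain ⟨z, hz, hz0⟩ := Submodule.exists_mem_ne_zero_of_ne_bot h
  rw [LinearMap.mem_ker] at hz
  exact ⟨z, hz0, congrFun hz 0, congrFun hz 1, congrFun hz 2⟩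

/-- A vector orthogonal to the first basis vector but not proportional to it can be moved to
`h_{2n-1}` by an element fixing the first basis vector. -/
theorem exists_fix_move_last (hn : 2 ≤ n) {x z : Vn F n} (hz : z ≠ 0)
    (hez : sB F n (bvec F n 0) z = 0) (hex : sB F n (bvec F n 0) x ≠ 0) (hxz : sB F n x z = 0) :
    ∃ g : SpV F n, g.1 (bvec F n 0) = bvec F n 0 ∧ g.1 z = bvec F n (2*n-2) := by
  obtain ⟨c, hc⟩ := exists_sB_ne_zero hz
  have mem : ∀ v, v ∈ LinearMap.ker (sDual (bvec F n 0)) ↔ sB F n (bvec F n 0) v = 0 :=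
    fun v => LinearMap.mem_ker
  obtain ⟨g, hg, hfix, -⟩ := exists_move_in (LinearMap.ker (sDual (bvec F n 0)))
    (x := z) (y := bvec F n (2*n-2)) ((mem _).mpr hez)
    ((mem _).mpr (sB_bvec_last_left hn (by omega)))
    ⟨c - (sB F n (bvec F n 0) c / sB F n (bvec F n 0) x) • x, by
      rw [mem, sB_sub_right, sB_smul_right, div_mul_cancel₀ _ hex, sub_self], by
      rwa [sB_sub_left, sB_smul_left, hxz, mul_zero, sub_zero]⟩
    ⟨bvec F n (2*n-1), (mem _).mpr (sB_bvec_zero_last hn), sB_bvec_last hn⟩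
  exact ⟨g, hfix _ fun v hv => sB_eq_zero_comm.mp ((mem v).mp hv), hg⟩

theorem exists_stab_two_move (hn : 2 ≤ n) :
    ∃ w ∈ stab F n 2, w ∈ stab F n (2*n-1) ∧ w.1 (bvec F n 0) = bvec F n 1 := by
  have hef : sB F n (bvec F n 0) (bvec F n 1) ≠ 0 := by
    rw [sB_bvec_zero_one hn]; exact one_ne_zero
  obtain ⟨w, hw, hfix, hU⟩ := exists_move_in (Cl F n 2) (bvec_mem_Cl two_pos)
    (bvec_mem_Cl one_lt_two) ⟨bvec F n 1, bvec_mem_Cl one_lt_two, sB_ne_zero_comm.mp hef⟩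
    ⟨bvec F n 0, bvec_mem_Cl two_pos, hef⟩
  refine ⟨w, (mem_stab (by omega) (by omega)).mpr hU, mem_stab_last_of_eq hn (hfix _ ?_), hw⟩
  intro v hv
  rw [← mem_Cl_last hn, mem_Cl]
  exact fun k hk => mem_Cl.mp hv k (by omega)

theorem exists_decomposition (hn : 2 ≤ n) {g : SpV F n}
    (hg : sB F n (bvec F n 0) (g.1 (bvec F n 0)) ≠ 0) :
    ∃ a ∈ stab F n 1, ∃ w ∈ stab F n 2, w ∈ stab F n (2*n-1) ∧ ∃ b ∈ stab F n 1, g = a * w * b ∧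
      (sB F n (g.1 (bvec F n 0)) (bvec F n (2*n-2)) = 0 → a ∈ stab F n (2*n-1)) := by
  obtain ⟨a, hae, haf, had⟩ := exists_fix_move_one hn hg
  obtain ⟨w, hw2, hw3, hw⟩ := exists_stab_two_move (F := F) hn
  refine ⟨a, mem_stab_one_of_eq hn hae, w, hw2, hw3, (a * w)⁻¹ * g, ?_,
    (mul_inv_cancel_left _ _).symm,
    fun h => mem_stab_last_of_eq hn (had h)⟩
  refine (mem_stab_one hn).mpr ⟨sB F n (bvec F n 0) (g.1 (bvec F n 0)), ?_⟩
  rw [coe_mul_apply, inv_apply_eq, map_smul, coe_mul_apply, hw, haf, smul_smul,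
    mul_inv_cancel₀ hg, one_smul]

/-- `P_{I-{l}}` is the product of its intersections with `P_{I-{2n-1}}` and `P_{I-{1}}`. -/
theorem exists_stab_decomposition (hn : 2 ≤ n) {l : ℕ} (h2 : 2 ≤ l) (hl : l ≤ 2*n-1)
    {g : SpV F n} (hg : g ∈ stab F n l) :
    ∃ u ∈ stab F n l, u ∈ stab F n (2*n-1) ∧ u⁻¹ * g ∈ stab F n 1 := by
  have hgU := (mem_stab (by omega) hl).mp hg
  have hfe : sB F n (bvec F n 1) (bvec F n 0) ≠ 0 := by
    rw [sB_ne_zero_comm, sB_bvec_zero_one hn]; exact one_ne_zero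
  obtain ⟨u, hu, hfix, hU⟩ := exists_move_in (Cl F n l) (bvec_mem_Cl (k := 0) (by omega))
    (hgU _ (bvec_mem_Cl (k := 0) (by omega))) ⟨bvec F n 1, bvec_mem_Cl (by omega), hfe⟩
    ⟨g.1 (bvec F n 1), hgU _ (bvec_mem_Cl (by omega)), by rwa [sB_map]⟩
  refine ⟨u, (mem_stab (by omega) hl).mpr hU, mem_stab_last_of_eq hn (hfix _ ?_),
    mem_stab_one_of_eq hn ?_⟩
  · intro v hv
    rw [← mem_Cl_last hn, mem_Cl]
    exact fun k hk => mem_Cl.mp hv k (by omega)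
  · rw [coe_mul_apply, inv_apply_eq, hu]

end

section
variable {F : Type} [Field F] {n : ℕ}

/-- The elements moving the point `⟨h_1⟩` to a point not orthogonal to it. -/
def hypSet (F : Type) [Field F] (n : ℕ) : Set (SpV F n) :=
  {g | sB F n (bvec F n 0) (g.1 (bvec F n 0)) ≠ 0}

theorem mem_hypSet {g : SpV F n} :
    g ∈ hypSet F n ↔ sB F n (bvec F n 0) (g.1 (bvec F n 0)) ≠ 0 := Iff.rfl

theorem inv_mul_mem_hypSet {g h : SpV F n} :
    g⁻¹ * h ∈ hypSet F n ↔ sB F n (g.1 (bvec F n 0)) (h.1 (bvec F n 0)) ≠ 0 := by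
  rw [mem_hypSet, coe_mul_apply, sB_inv_right]

theorem mul_mem_hypSet_left (hn : 2 ≤ n) {a : SpV F n} (ha : a ∈ stab F n 1) {s : SpV F n}
    (hs : s ∈ hypSet F n) : a * s ∈ hypSet F n := by
  obtain ⟨c, hc⟩ := (mem_stab_one hn).mp ((stab F n 1).inv_mem ha)
  rw [← inv_inv a, inv_mul_mem_hypSet, hc, sB_smul_left]
  refine mul_ne_zero ?_ hs
  rintro rfl
  rw [zero_smul, inv_apply_eq, map_zero] at hc
  exact bvec_zero_ne_zero hn hc

theorem mul_mem_hypSet_right (hn : 2 ≤ n) {a : SpV F n} (ha : a ∈ stab F n 1) {s : SpV F n}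
    (hs : s ∈ hypSet F n) : s * a ∈ hypSet F n := by
  obtain ⟨c, hc⟩ := (mem_stab_one hn).mp ha
  rw [mem_hypSet, coe_mul_apply, hc, map_smul, sB_smul_right]
  refine mul_ne_zero ?_ hs
  rintro rfl
  rw [zero_smul] at hc
  exact bvec_zero_ne_zero hn (a.1.injective (by rw [hc, map_zero]))

theorem mem_stab_one_of_notMem_hypSet (hn : 2 ≤ n) {w : SpV F n} (hw : w ∈ stab F n 2)
    (h : w ∉ hypSet F n) : w ∈ stab F n 1 := by
  obtain ⟨a, b, hab⟩ := (mem_Cl_two hn).mp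
    ((mem_stab (by omega) (by omega)).mp hw _ (bvec_mem_Cl two_pos))
  rw [mem_hypSet, not_not, hab, sB_add_right, sB_smul_right, sB_smul_right, sB_self,
    sB_bvec_zero_one hn] at h
  obtain rfl : b = 0 := by simpa using h
  exact (mem_stab_one hn).mpr ⟨a, by rw [hab]; simp⟩

theorem mem_stab_two_of_inv_mul_mem (hn : 2 ≤ n) {a w w' : SpV F n} (ha : a ∈ stab F n 1)
    (hw : w ∈ stab F n 2) (hw' : w' ∈ stab F n 2) (hwS : w ∈ hypSet F n)
    (h : w'⁻¹ * (a * w) ∈ stab F n 1) : a ∈ stab F n 2 := by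
  have mem2 : ∀ {g : SpV F n}, g ∈ stab F n 2 ↔ _ := mem_stab (by omega) (by omega)
  obtain ⟨c, hc⟩ := (mem_stab_one hn).mp ha
  obtain ⟨b, hb⟩ := (mem_stab_one hn).mp h
  obtain ⟨α, β, hαβ⟩ := (mem_Cl_two hn).mp (mem2.mp hw _ (bvec_mem_Cl two_pos))
  rw [mem_hypSet, hαβ, sB_add_right, sB_smul_right, sB_smul_right, sB_self,
    sB_bvec_zero_one hn] at hwS
  have hβ : β ≠ 0 := by simpa using hwS
  have h0 : a.1 (bvec F n 0) ∈ Cl F n 2 := by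
    rw [hc]; exact Submodule.smul_mem _ _ (bvec_mem_Cl two_pos)
  have h1 : a.1 (bvec F n 1) ∈ Cl F n 2 := by
    rw [coe_mul_apply, inv_apply_eq, map_smul, coe_mul_apply, hαβ, map_add, map_smul,
      map_smul] at hb
    have h2 : β • a.1 (bvec F n 1) ∈ Cl F n 2 := by
      rw [← add_sub_cancel_left (α • a.1 (bvec F n 0)) (β • a.1 (bvec F n 1)), hb]
      exact Submodule.sub_mem _ (Submodule.smul_mem _ _ (mem2.mp hw' _ (bvec_mem_Cl two_pos)))
        (Submodule.smul_mem _ _ h0)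
    exact (Submodule.smul_mem_iff _ hβ).mp h2
  rw [mem2]
  intro u hu
  obtain ⟨x, y, rfl⟩ := (mem_Cl_two hn).mp hu
  rw [map_add, map_smul, map_smul]
  exact Submodule.add_mem _ (Submodule.smul_mem _ _ h0) (Submodule.smul_mem _ _ h1)

theorem map_bvec_zero_ne_zero (hn : 2 ≤ n) (g : SpV F n) : g.1 (bvec F n 0) ≠ 0 := by
  rw [Ne, LinearEquiv.map_eq_zero_iff]
  exact bvec_zero_ne_zero hn

theorem exists_mem_hypSet_move (hn : 2 ≤ n) {r : Vn F n} (hr : sB F n (bvec F n 0) r ≠ 0) :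
    ∃ s ∈ hypSet F n, s.1 (bvec F n 0) = r := by
  obtain ⟨s, rfl⟩ := exists_move_first hn (x := r) (by rintro rfl; simp [sB] at hr)
  exact ⟨s, hr, rfl⟩

theorem exists_mem_hypSet_inv_mul_mem (hn : 2 ≤ n) (g : SpV F n) :
    ∃ s ∈ hypSet F n, s⁻¹ * g ∈ hypSet F n := by
  obtain ⟨c, hc⟩ := exists_sB_ne_zero (bvec_zero_ne_zero (F := F) hn)
  obtain ⟨c', hc'⟩ := exists_sB_ne_zero (map_bvec_zero_ne_zero hn g)
  obtain ⟨r, -, hr, hr'⟩ := exists_common_ne_zero ⊤ ⟨c, trivial, hc⟩ ⟨c', trivial, hc'⟩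
  obtain ⟨s, hs, rfl⟩ := exists_mem_hypSet_move hn (sB_ne_zero_comm.mp hr)
  exact ⟨s, hs, inv_mul_mem_hypSet.mpr hr'⟩

theorem exists_mem_stab_last_of_mem (hn : 2 ≤ n) {g : SpV F n} (hg : g ∈ stab F n (2*n-1)) :
    ∃ s ∈ hypSet F n, s ∈ stab F n (2*n-1) ∧ s⁻¹ * g ∈ hypSet F n := by
  have hgU := (mem_stab (by omega) le_rfl).mp hg
  have hfe : sB F n (bvec F n 1) (bvec F n 0) ≠ 0 := by
    rw [sB_ne_zero_comm, sB_bvec_zero_one hn]; exact one_ne_zero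
  have hf : bvec F n 1 ∈ Cl F n (2*n-1) := bvec_mem_Cl (by omega)
  obtain ⟨r, hrU, hr, hr'⟩ := exists_common_ne_zero (Cl F n (2*n-1)) ⟨_, hf, hfe⟩
    (y := g.1 (bvec F n 0)) ⟨_, hgU _ hf, by rwa [sB_map]⟩
  obtain ⟨s, hs, rfl⟩ := exists_stab_last_move hn ((mem_Cl_last hn).mp hrU)
    ⟨bvec F n 0, sB_bvec_last_left hn (by omega), sB_ne_zero_comm.mp hr⟩
  exact ⟨s, sB_ne_zero_comm.mp hr, hs, inv_mul_mem_hypSet.mpr hr'⟩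

theorem exists_triangle_move (hn : 2 ≤ n) {g h : SpV F n} (hg : g ∈ hypSet F n)
    (hgh : g * h ∈ hypSet F n) :
    ∃ a ∈ stab F n 1, ∃ b ∈ stab F n 1, ∃ c ∈ stab F n 1,
      a * g * b ∈ stab F n (2*n-1) ∧ b⁻¹ * h * c ∈ stab F n (2*n-1) := by
  obtain ⟨z, hz, h0, h1, h2⟩ := exists_orthogonal_ne_zero hn (bvec F n 0) (g.1 (bvec F n 0))
    ((g * h).1 (bvec F n 0))
  obtain ⟨a, hae, haz⟩ := exists_fix_move_last hn hz h0 hg h1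
  have move : ∀ k : SpV F n, k ∈ hypSet F n → sB F n (k.1 (bvec F n 0)) z = 0 →
      ∃ u ∈ stab F n (2*n-1), u.1 (bvec F n 0) = (a * k).1 (bvec F n 0) := by
    intro k hk hkz
    refine exists_stab_last_move hn ?_ ⟨bvec F n 0, sB_bvec_last_left hn (by omega), ?_⟩
    · rw [← haz, coe_mul_apply, sB_map, hkz]
    · exact mul_mem_hypSet_left hn (mem_stab_one_of_eq hn hae) hk
  obtain ⟨u, hu, hue⟩ := move g hg h1
  obtain ⟨v, hv, hve⟩ := move (g * h) hgh h2
  refine ⟨a, mem_stab_one_of_eq hn hae, (a * g)⁻¹ * u, mem_stab_one_of_eq hn ?_,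
    (a * (g * h))⁻¹ * v, mem_stab_one_of_eq hn ?_, ?_, ?_⟩
  · rw [coe_mul_apply, inv_apply_eq, hue]
  · rw [coe_mul_apply, inv_apply_eq, hve]
  · rwa [mul_inv_cancel_left]
  · have e : ((a * g)⁻¹ * u)⁻¹ * h * ((a * (g * h))⁻¹ * v) = u⁻¹ * v := by group
    rw [e]
    exact Subgroup.mul_mem _ (Subgroup.inv_mem _ hu) hv

theorem exists_quadrangle_center (hn : 2 ≤ n) {g s t : SpV F n} (hg : g ∉ hypSet F n)
    (hs : s ∈ hypSet F n) (hsg : s⁻¹ * g ∈ hypSet F n) (ht : t ∈ hypSet F n)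
    (hst : s⁻¹ * t ∉ hypSet F n) :
    ∃ u ∈ hypSet F n, u⁻¹ * g ∈ hypSet F n ∧ s⁻¹ * u ∈ hypSet F n ∧ t⁻¹ * u ∈ hypSet F n := by
  rw [inv_mul_mem_hypSet] at hsg hst
  rw [mem_hypSet] at hs ht hg
  rw [not_not] at hg hst
  obtain ⟨u, hu, hur⟩ := exists_mem_hypSet_move hn (r := bvec F n 0 + s.1 (bvec F n 0))
    (by simpa [sB_add_right, sB_self] using hs)
  refine ⟨u, hu, ?_, ?_, ?_⟩ <;> rw [inv_mul_mem_hypSet, hur]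
  · simpa [sB_add_left, hg] using hsg
  · simpa [sB_add_right, sB_self] using sB_ne_zero_comm.mp hs
  · simpa [sB_add_right, sB_eq_zero_comm.mp hst] using sB_ne_zero_comm.mp ht

/-- Given `x`, `y` not orthogonal and `p` orthogonal to `x` or `y`, there is a vector
orthogonal to none of `p`, `x`, `y`. -/
theorem exists_common_ne_zero_three {p x y : Vn F n} (hp : p ≠ 0) (hxy : sB F n x y ≠ 0)
    (h : ¬ (sB F n p x ≠ 0 ∧ sB F n p y ≠ 0)) :
    ∃ v, sB F n p v ≠ 0 ∧ sB F n v x ≠ 0 ∧ sB F n v y ≠ 0 := by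
  have hyx := sB_ne_zero_comm.mp hxy
  by_cases hx : sB F n p x = 0
  · by_cases hy : sB F n p y = 0
    · obtain ⟨z, hz⟩ := exists_sB_ne_zero hp
      refine ⟨z + ((1 - sB F n z y) / sB F n x y) • x + ((1 - sB F n z x) / sB F n y x) • y,
        ?_, ?_, ?_⟩
      · simpa [sB_add_right, sB_smul_right, hx, hy] using sB_ne_zero_comm.mp hz
      · simp [sB_add_left, sB_smul_left, sB_self, hyx]
      · simp [sB_add_left, sB_smul_left, sB_self, hxy]
    · exact ⟨x + y, by simpa [sB_add_right, hx] using hy,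
        by simpa [sB_add_left, sB_self] using hyx, by simpa [sB_add_left, sB_self] using hxy⟩
  · have hy : sB F n p y = 0 := by
      by_contra hy
      exact h ⟨hx, hy⟩
    exact ⟨x + y, by simpa [sB_add_right, hy] using hx,
        by simpa [sB_add_left, sB_self] using hyx, by simpa [sB_add_left, sB_self] using hxy⟩

theorem exists_triple_center (hn : 2 ≤ n) {g h : SpV F n} (hh : h ∈ hypSet F n)
    (hc : ¬ (g ∈ hypSet F n ∧ g * h ∈ hypSet F n)) :
    ∃ s ∈ hypSet F n, s⁻¹ * g ∈ hypSet F n ∧ s⁻¹ * (g * h) ∈ hypSet F n := by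
  obtain ⟨v, h1, h2, h3⟩ := exists_common_ne_zero_three (bvec_zero_ne_zero hn)
    (x := g.1 (bvec F n 0)) (y := (g * h).1 (bvec F n 0))
    (by rw [coe_mul_apply, sB_map]; exact hh) hc
  obtain ⟨s, hs, rfl⟩ := exists_mem_hypSet_move hn h1
  exact ⟨s, hs, inv_mul_mem_hypSet.mpr h2, inv_mul_mem_hypSet.mpr h3⟩

theorem exists_monoidHom_of_stab (hn : 2 ≤ n) {K : Type*} [Group K] (p q r : SpV F n → K)
    (hp : MulOn (stab F n 1) p) (hq : MulOn (stab F n 2) q) (hr : MulOn (stab F n (2*n-1)) r)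
    (hpq : ∀ g ∈ stab F n 1, g ∈ stab F n 2 → p g = q g)
    (hpr : ∀ g ∈ stab F n 1, g ∈ stab F n (2*n-1) → p g = r g)
    (hqr : ∀ g ∈ stab F n 2, g ∈ stab F n (2*n-1) → q g = r g) :
    ∃ Φ : SpV F n →* K, (∀ g ∈ stab F n 1, Φ g = p g) ∧ (∀ g ∈ stab F n 2, Φ g = q g) ∧
      ∀ g ∈ stab F n (2*n-1), Φ g = r g := by
  refine exists_monoidHom_of_three_subgroups _ _ _ (hypSet F n) p q r hp hq hr hpq hpr hqr
    (fun a ha s hs => mul_mem_hypSet_left hn ha hs)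
    (fun a ha s hs => mul_mem_hypSet_right hn ha hs) ?_
    (fun w hw h => mem_stab_one_of_notMem_hypSet hn hw h)
    (fun a ha w hw w' hw' hwS _ h => mem_stab_two_of_inv_mul_mem hn ha hw hw' hwS h) ?_
    (fun g hg => exists_mem_stab_last_of_mem hn hg)
    (fun g hg h _ hgh => exists_triangle_move hn hg hgh)
    (exists_mem_hypSet_inv_mul_mem hn)
    (fun g s t hg hs hsg ht _ hst => exists_quadrangle_center hn hg hs hsg ht hst)
    (fun g h hh hc => exists_triple_center hn hh hc)
  · intro g hg
    obtain ⟨a, ha, w, hw, -, b, hb, he, -⟩ := exists_decomposition hn hg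
    exact ⟨a, ha, w, hw, b, hb, he⟩
  · intro g hg hgR
    obtain ⟨a, ha, w, hw, hwR, b, hb, he, haR⟩ := exists_decomposition hn hg
    have haR' := haR ((mem_Cl_last hn).mp
      ((mem_stab (by omega) le_rfl).mp hgR _ (bvec_mem_Cl (by omega))))
    refine ⟨a, ⟨ha, haR'⟩, w, ⟨hw, hwR⟩, b, ⟨hb, ?_⟩, he⟩
    have : b = (a * w)⁻¹ * g := by rw [he]; group
    rw [this]
    exact Subgroup.mul_mem _ (Subgroup.inv_mem _ (Subgroup.mul_mem _ haR' hwR)) hgR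

/-- The symplectic group is generated by the stabilizers of `C_1` and `C_2`. -/
theorem mem_of_stab_le (hn : 2 ≤ n) (H : Subgroup (SpV F n)) (h1 : stab F n 1 ≤ H)
    (h2 : stab F n 2 ≤ H) (g : SpV F n) : g ∈ H := by
  have hyp : ∀ g ∈ hypSet F n, g ∈ H := by
    intro g hg
    obtain ⟨a, ha, w, hw, -, b, hb, rfl, -⟩ := exists_decomposition hn hg
    exact H.mul_mem (H.mul_mem (h1 ha) (h2 hw)) (h1 hb)
  obtain ⟨s, hs, hsg⟩ := exists_mem_hypSet_inv_mul_mem hn g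
  simpa using H.mul_mem (hyp s hs) (hyp _ hsg)

end

section
variable {F : Type} [Field F] {n : ℕ}

/-- A family of multiplicative maps on the stabilizers of the `C_l` that agree on intersections
extends uniquely to the symplectic group. -/
theorem existsUnique_monoidHom_of_stab (hn : 2 ≤ n) {K : Type*} [Group K] (φ : ℕ → SpV F n → K)
    (hmul : ∀ l ∈ Finset.Icc 1 (2*n-1), MulOn (stab F n l) (φ l))
    (hagree : ∀ l ∈ Finset.Icc 1 (2*n-1), ∀ m ∈ Finset.Icc 1 (2*n-1), ∀ g,
      g ∈ stab F n l → g ∈ stab F n m → φ l g = φ m g) :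
    ∃! Φ : SpV F n →* K, ∀ l ∈ Finset.Icc 1 (2*n-1), ∀ g ∈ stab F n l, Φ g = φ l g := by
  have i1 : 1 ∈ Finset.Icc 1 (2*n-1) := Finset.mem_Icc.mpr ⟨le_rfl, by omega⟩
  have i2 : 2 ∈ Finset.Icc 1 (2*n-1) := Finset.mem_Icc.mpr ⟨by omega, by omega⟩
  have i3 : 2*n-1 ∈ Finset.Icc 1 (2*n-1) := Finset.mem_Icc.mpr ⟨by omega, le_rfl⟩
  obtain ⟨Φ, h1, h2, h3⟩ := exists_monoidHom_of_stab hn (φ 1) (φ 2) (φ (2*n-1)) (hmul 1 i1)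
    (hmul 2 i2) (hmul _ i3) (hagree 1 i1 2 i2) (hagree 1 i1 _ i3) (hagree 2 i2 _ i3)
  refine ⟨Φ, ?_, ?_⟩
  · intro l hl g hg
    obtain ⟨hl1, hl2⟩ := Finset.mem_Icc.mp hl
    obtain rfl | hl1 := hl1.eq_or_lt
    · exact h1 g hg
    obtain ⟨u, hu, hu3, hug⟩ := exists_stab_decomposition hn hl1 hl2 hg
    have hugl := Subgroup.mul_mem _ (Subgroup.inv_mem _ hu) hg
    have e : g = u * (u⁻¹ * g) := by simp
    rw [e, map_mul, h3 u hu3, h1 _ hug, hmul l hl u hu _ hugl, hagree l hl _ i3 u hu hu3,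
      hagree l hl _ i1 _ hugl hug]
  · intro Ψ hΨ
    have hle1 : stab F n 1 ≤ Ψ.eqLocus Φ := fun g hg => (hΨ 1 i1 g hg).trans (h1 g hg).symm
    have hle2 : stab F n 2 ≤ Ψ.eqLocus Φ := fun g hg => (hΨ 2 i2 g hg).trans (h2 g hg).symm
    exact MonoidHom.ext fun g => mem_of_stab_le hn _ hle1 hle2 g

theorem closure_Par (hn : 2 ≤ n) :
    Subgroup.closure (⋃ l ∈ Finset.Icc 1 (2*n-1),
      ((Par F n ((Finset.Icc 1 (2*n-1)) \ {l}) : Subgroup ((Vn F n) ≃ₗ[F] (Vn F n))) :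
        Set ((Vn F n) ≃ₗ[F] (Vn F n)))) = SpV F n := by
  apply le_antisymm
  · rw [Subgroup.closure_le]
    exact Set.iUnion₂_subset fun l _ => Par_le_SpV F n _
  · intro g hg
    have hle : ∀ l ∈ Finset.Icc 1 (2*n-1), stab F n l ≤ (Subgroup.closure
        (⋃ l ∈ Finset.Icc 1 (2*n-1), ((Par F n ((Finset.Icc 1 (2*n-1)) \ {l}) :
          Subgroup ((Vn F n) ≃ₗ[F] (Vn F n))) : Set ((Vn F n) ≃ₗ[F] (Vn F n))))).subgroupOf
          (SpV F n) := fun l hl x hx =>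
      Subgroup.subset_closure (Set.mem_iUnion₂.mpr ⟨l, hl, hx⟩)
    exact mem_of_stab_le hn _ (hle 1 (Finset.mem_Icc.mpr ⟨le_rfl, by omega⟩))
      (hle 2 (Finset.mem_Icc.mpr ⟨by omega, by omega⟩)) ⟨g, hg⟩

end

/-- **`Sp_{2n}(F)` is the universal completion of the amalgam of the maximal parabolic
subgroups `P_{I−{l}}`, `l ∈ I = {1,…,2n−1}`, for its action on the geometry `Γ`.** -/
theorem sp_universal_completion_max_parabolics (F : Type) [Field F] (n : ℕ) (hn : 2 ≤ n) :
    (Subgroup.closure (⋃ l ∈ Finset.Icc 1 (2*n-1),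
        ((Par F n ((Finset.Icc 1 (2*n-1)) \ {l}) : Subgroup ((Vn F n) ≃ₗ[F] (Vn F n))) :
          Set ((Vn F n) ≃ₗ[F] (Vn F n)))) = SpV F n) ∧
    (∀ (K : Type) [Group K]
      (f : (l : ℕ) → l ∈ Finset.Icc 1 (2*n-1) → ↥(Par F n ((Finset.Icc 1 (2*n-1)) \ {l})) →* K),
      (∀ (l : ℕ) (hl : l ∈ Finset.Icc 1 (2*n-1)) (m : ℕ) (hm : m ∈ Finset.Icc 1 (2*n-1))
        (g : ↥(Par F n ((Finset.Icc 1 (2*n-1)) \ {l}) ⊓ Par F n ((Finset.Icc 1 (2*n-1)) \ {m}))),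
        f l hl (Subgroup.inclusion inf_le_left g) = f m hm (Subgroup.inclusion inf_le_right g)) →
      ∃! Φ : ↥(SpV F n) →* K,
        ∀ (l : ℕ) (hl : l ∈ Finset.Icc 1 (2*n-1))
          (g : ↥(Par F n ((Finset.Icc 1 (2*n-1)) \ {l}))),
          Φ (Subgroup.inclusion (Par_le_SpV F n _) g) = f l hl g) := by
  refine ⟨closure_Par hn, ?_⟩
  intro K _ f hf
  classical
  obtain ⟨φ, hφ⟩ : ∃ φ : ℕ → SpV F n → K, ∀ l (hl : l ∈ Finset.Icc 1 (2*n-1)) (g : SpV F n)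
      (hg : g.1 ∈ Par F n (Finset.Icc 1 (2*n-1) \ {l})), φ l g = f l hl ⟨g.1, hg⟩ :=
    ⟨fun l g => if h : l ∈ Finset.Icc 1 (2*n-1) ∧ g.1 ∈ Par F n (Finset.Icc 1 (2*n-1) \ {l})
      then f l h.1 ⟨g.1, h.2⟩ else 1, fun l hl g hg => dif_pos ⟨hl, hg⟩⟩
  obtain ⟨Φ, hΦ, huniq⟩ := existsUnique_monoidHom_of_stab hn φ (by
      intro l hl a ha b hb
      have hab : (a * b).1 ∈ Par F n (Finset.Icc 1 (2*n-1) \ {l}) :=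
        Subgroup.mul_mem (stab F n l) ha hb
      rw [hφ l hl a ha, hφ l hl b hb, hφ l hl (a * b) hab]
      exact map_mul (f l hl) ⟨a.1, ha⟩ ⟨b.1, hb⟩) (by
      intro l hl m hm g hgl hgm
      rw [hφ l hl g hgl, hφ m hm g hgm]
      exact hf l hl m hm ⟨g.1, hgl, hgm⟩)
  refine ⟨Φ, ?_, ?_⟩
  · rintro l hl ⟨g, hg⟩
    have h1 := hΦ l hl ⟨g, Par_le_SpV F n _ hg⟩ hg
    rw [hφ l hl ⟨g, Par_le_SpV F n _ hg⟩ hg] at h1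
    exact h1
  · intro Ψ hΨ
    refine huniq Ψ ?_
    rintro l hl ⟨g, hg'⟩ hg
    have h1 := hΨ l hl ⟨g, hg⟩
    rw [hφ l hl ⟨g, hg'⟩ hg]
    exact h1
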